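/- Tauberian theorem for the Weyl law: let n ≥ 1 be an integer, let (λ_j)_{j ∈ ℕ} be a nondecreasing sequence of nonnegative reals with λ_j → ∞, and let N(λ) = #{ j : λ_j ≤ λ }. Let ρ ∈ 𝒮(ℝ) be real-valued with ρ(λ) > 0 for all λ and ∫_ℝ ρ(λ) dλ = 1. Suppose there are constants A, A', B > 0 such that (i) Σ_j ρ(λ − λ_j) ≤ A (1 + |λ|)^{n−1} for every λ ∈ ℝ, and (ii) | (ρ * N)(λ) − B λⁿ | ≤ A' λ^{n−1} for every λ ≥ 1, where (ρ * N)(λ) = ∫_ℝ ρ(λ − μ) N(μ) dμ. Then there is a constant C such that | N(λ) − B λⁿ | ≤ C λ^{n−1} for every λ ≥ 1. -/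

import Mathlib

open Filter MeasureTheory

/-- The counting function `N(μ) = #{ j : λ_j ≤ μ }` of a sequence `l : ℕ → ℝ`. -/
noncomputable def countingFun (l : ℕ → ℝ) (μ : ℝ) : ℕ :=
  Nat.card {j : ℕ | l j ≤ μ}

lemma finite_setOf_le_of_tendsto {l : ℕ → ℝ} (htop : Tendsto l atTop atTop) (x : ℝ) :
    {j : ℕ | l j ≤ x}.Finite := by
  have h := htop.eventually_gt_atTop x
  rw [← Nat.cofinite_eq_atTop, Filter.eventually_cofinite] at h
  simpa only [not_lt] using h

lemma countingFun_mono {l : ℕ → ℝ} (htop : Tendsto l atTop atTop) :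
    Monotone (countingFun l) := fun _ y hxy =>
  Nat.card_mono (finite_setOf_le_of_tendsto htop y) fun _ hj => le_trans hj hxy

/-- A bound on the sums of a positive kernel bounds the number of points in unit intervals. -/
lemma countingFun_add_one_le {l : ℕ → ℝ} (htop : Tendsto l atTop atTop) {f : ℝ → ℝ} {c : ℝ}
    (hc : 0 < c) (hf : ∀ t ∈ Set.Icc (-1 : ℝ) 0, c ≤ f t) {x b : ℝ} (hb : 0 ≤ b)
    (hsum : (∑' j : ℕ, ENNReal.ofReal (f (x - l j))) ≤ ENNReal.ofReal b) :
    (countingFun l (x + 1) : ℝ) ≤ countingFun l x + b / c := by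
  have hS : {j : ℕ | x < l j ∧ l j ≤ x + 1}.Finite :=
    (finite_setOf_le_of_tendsto htop (x + 1)).subset fun j hj => hj.2
  have hcard : countingFun l (x + 1) ≤ countingFun l x + hS.toFinset.card := by
    rw [← Set.ncard_eq_toFinset_card _ hS]
    refine (Set.ncard_le_ncard (fun j hj => ?_)
      ((finite_setOf_le_of_tendsto htop x).union hS)).trans (Set.ncard_union_le _ _)
    rcases le_or_gt (l j) x with h | h
    · exact Or.inl h
    · exact Or.inr ⟨h, hj⟩
  have hle : (hS.toFinset.card : ℝ) * c ≤ b := by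
    rw [← ENNReal.ofReal_le_ofReal_iff hb, ENNReal.ofReal_mul (Nat.cast_nonneg _),
      ENNReal.ofReal_natCast, ← nsmul_eq_mul]
    refine le_trans ?_ ((ENNReal.sum_le_tsum hS.toFinset).trans hsum)
    refine Finset.card_nsmul_le_sum _ _ _ fun j hj => ENNReal.ofReal_le_ofReal (hf _ ?_)
    have hj' := (Set.Finite.mem_toFinset hS).1 hj
    constructor <;> linarith [hj'.1, hj'.2]
  have hcard' : (countingFun l (x + 1) : ℝ) ≤ countingFun l x + hS.toFinset.card := by
    exact_mod_cast hcard
  linarith [(le_div_iff₀ hc).2 hle]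

/-- Chaining unit-step increments of a monotone function. -/
lemma Monotone.le_add_of_unit_steps {N : ℝ → ℝ} (hN : Monotone N) {M D : ℝ} (hD : 0 ≤ D)
    (hstep : ∀ x, |x| ≤ M → N (x + 1) ≤ N x + D) (k : ℕ) :
    ∀ x y, |x| ≤ M → y ≤ M → y ≤ x + k → N y ≤ N x + k * D := by
  induction k with
  | zero =>
    intro x y _ _ hyx
    simpa using hN (by simpa using hyx)
  | succ k ih =>
    intro x y hx hy hyx
    push_cast at hyx ⊢
    have hx1 := hstep x hx
    rcases le_or_gt y (x + 1) with h | h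
    · nlinarith [hN h, mul_nonneg k.cast_nonneg hD]
    · have := ih (x + 1) y (abs_le.2 ⟨by linarith [(abs_le.1 hx).1], by linarith⟩) hy
        (by linarith)
      linarith

lemma Monotone.abs_sub_le_of_unit_steps {N : ℝ → ℝ} (hN : Monotone N) {K : ℝ} (hK : 0 ≤ K)
    {m : ℕ} (hstep : ∀ x, N (x + 1) ≤ N x + K * (1 + |x|) ^ m) (x t : ℝ) :
    |N x - N (x - t)| ≤ K * (1 + |x|) ^ m * (1 + |t|) ^ (m + 1) := by
  have hD : 0 ≤ K * (1 + (|x| + |t|)) ^ m := by positivity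
  have hsteps := hN.le_add_of_unit_steps hD (M := |x| + |t|) (fun y hy =>
    (hstep y).trans (by gcongr)) ⌈|t|⌉₊
  have hk : |t| ≤ ⌈|t|⌉₊ := Nat.le_ceil _
  have hk' : (⌈|t|⌉₊ : ℝ) ≤ 1 + |t| := by linarith [Nat.ceil_lt_add_one (abs_nonneg t)]
  have hxt : |x - t| ≤ |x| + |t| := abs_sub x t
  have h₁ := hsteps x (x - t) (by linarith [abs_nonneg t]) ((le_abs_self _).trans hxt)
    (by linarith [neg_abs_le t])
  have h₂ := hsteps (x - t) x hxt (by linarith [abs_nonneg t, le_abs_self x])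
    (by linarith [le_abs_self t])
  calc |N x - N (x - t)| ≤ ⌈|t|⌉₊ * (K * (1 + (|x| + |t|)) ^ m) :=
        abs_le.2 ⟨by linarith, by linarith⟩
    _ ≤ (1 + |t|) * (K * ((1 + |x|) * (1 + |t|)) ^ m) := by
        gcongr
        nlinarith [mul_nonneg (abs_nonneg x) (abs_nonneg t)]
    _ = K * (1 + |x|) ^ m * (1 + |t|) ^ (m + 1) := by rw [mul_pow]; ring

lemma SchwartzMap.integrable_one_add_abs_pow_mul (ρ : SchwartzMap ℝ ℝ) (k : ℕ) :
    Integrable fun t : ℝ => (1 + |t|) ^ k * |ρ t| := by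
  have h : Integrable fun t : ℝ => 2 ^ (k - 1) * (|ρ t| + ‖t‖ ^ k * ‖ρ t‖) :=
    (ρ.integrable.norm.add (ρ.integrable_pow_mul volume k)).const_mul _
  refine h.mono' ?_ (.of_forall fun t => ?_)
  · have := ρ.continuous
    exact Continuous.aestronglyMeasurable (by fun_prop)
  · rw [Real.norm_of_nonneg (by positivity)]
    have := mul_le_mul_of_nonneg_right
      (add_pow_le (zero_le_one' ℝ) (abs_nonneg t) k) (abs_nonneg (ρ t))
    simp only [Real.norm_eq_abs]
    rw [one_pow] at this
    linarith

/-- Averaging a function of controlled oscillation against a Schwartz kernel of integral one. -/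
lemma SchwartzMap.abs_sub_integral_le (ρ : SchwartzMap ℝ ℝ) (hρ : ∫ x, ρ x = 1)
    {N : ℝ → ℝ} (hN : Measurable N) {x D : ℝ} {k : ℕ}
    (hosc : ∀ t, |N x - N (x - t)| ≤ D * (1 + |t|) ^ k) :
    |N x - ∫ y, ρ (x - y) * N y| ≤ D * ∫ t, (1 + |t|) ^ k * |ρ t| := by
  have hint := (ρ.integrable_one_add_abs_pow_mul k).const_mul D
  have hbound : ∀ t, ‖ρ t * (N x - N (x - t))‖ ≤ D * ((1 + |t|) ^ k * |ρ t|) := fun t => by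
    rw [norm_mul, Real.norm_eq_abs, Real.norm_eq_abs]
    linarith [mul_le_mul_of_nonneg_left (hosc t) (abs_nonneg (ρ t))]
  have hdiff : Integrable fun t => ρ t * (N x - N (x - t)) := by
    refine hint.mono' ?_ (.of_forall hbound)
    have := ρ.continuous.measurable
    exact Measurable.aestronglyMeasurable (by fun_prop)
  have hconv : ∫ y, ρ (x - y) * N y = N x - ∫ t, ρ t * (N x - N (x - t)) := by
    rw [← integral_sub_left_eq_self _ volume x]
    calc ∫ t, ρ (x - (x - t)) * N (x - t)
        = ∫ t, (ρ t * N x - ρ t * (N x - N (x - t))) := by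
          congr 1
          ext t
          rw [sub_sub_cancel]
          ring
      _ = _ := by
          rw [integral_sub (ρ.integrable.mul_const _) hdiff, integral_mul_const, hρ, one_mul]
  rw [hconv, sub_sub_cancel, ← integral_const_mul]
  exact norm_integral_le_of_norm_le hint (.of_forall hbound)

/-- **Tauberian theorem for the Weyl law**: let `(λ_j)` be a nondecreasing sequence of
nonnegative reals tending to `∞` with counting function `N`, and let `ρ` be a strictly
positive real-valued Schwartz function with `∫ ρ = 1`.  If
(i) `Σ_j ρ(λ − λ_j) ≤ A (1+|λ|)^{n−1}` for all `λ`, and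
(ii) `|(ρ * N)(λ) − B λⁿ| ≤ A' λ^{n−1}` for all `λ ≥ 1`,
then `|N(λ) − B λⁿ| ≤ C λ^{n−1}` for all `λ ≥ 1`. -/
theorem tauberian_weyl (n : ℕ) (hn : 1 ≤ n)
    (l : ℕ → ℝ) (hmono : Monotone l) (hpos : ∀ j, 0 ≤ l j)
    (htop : Tendsto l atTop atTop)
    (ρ : SchwartzMap ℝ ℝ) (hρpos : ∀ x : ℝ, 0 < ρ x)
    (hρint : ∫ x : ℝ, ρ x = 1)
    (A A' B : ℝ) (hA : 0 < A) (hA' : 0 < A') (hB : 0 < B)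
    (hsum : ∀ μ : ℝ, (∑' j : ℕ, ENNReal.ofReal (ρ (μ - l j)))
      ≤ ENNReal.ofReal (A * (1 + |μ|) ^ (n - 1)))
    (hconv : ∀ μ : ℝ, 1 ≤ μ →
      |(∫ ν : ℝ, ρ (μ - ν) * (countingFun l ν : ℝ)) - B * μ ^ n| ≤ A' * μ ^ (n - 1)) :
    ∃ C : ℝ, ∀ μ : ℝ, 1 ≤ μ →
      |(countingFun l μ : ℝ) - B * μ ^ n| ≤ C * μ ^ (n - 1) := by
  obtain ⟨m, rfl⟩ : ∃ m, n = m + 1 := ⟨n - 1, by omega⟩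
  simp only [Nat.add_sub_cancel] at *
  obtain ⟨t₀, -, ht₀⟩ := isCompact_Icc.exists_isMinOn
    (Set.nonempty_Icc.2 (by norm_num : (-1 : ℝ) ≤ 0)) ρ.continuous.continuousOn
  set K := A / ρ t₀
  have hK : 0 ≤ K := (div_pos hA (hρpos t₀)).le
  have hmonoN : Monotone fun x => (countingFun l x : ℝ) :=
    Nat.mono_cast.comp (countingFun_mono htop)
  have hstep : ∀ x : ℝ,
      (countingFun l (x + 1) : ℝ) ≤ countingFun l x + K * (1 + |x|) ^ m := fun x => by
    refine (countingFun_add_one_le htop (hρpos t₀) ht₀ (by positivity) (hsum x)).trans_eq ?_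
    rw [mul_div_right_comm]
  set J := ∫ t, (1 + |t|) ^ (m + 1) * |ρ t|
  have hJ : 0 ≤ J := integral_nonneg fun t => by positivity
  refine ⟨A' + K * 2 ^ m * J, fun μ hμ => ?_⟩
  have havg := ρ.abs_sub_integral_le hρint hmonoN.measurable
    (hmonoN.abs_sub_le_of_unit_steps hK hstep μ)
  have hpow : (1 + |μ|) ^ m ≤ 2 ^ m * μ ^ m := by
    rw [← mul_pow, abs_of_pos (by linarith)]
    gcongr
    linarith
  calc _ ≤ _ := abs_sub_le _ (∫ ν : ℝ, ρ (μ - ν) * (countingFun l ν : ℝ)) _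
    _ ≤ K * (2 ^ m * μ ^ m) * J + A' * μ ^ m :=
        add_le_add (havg.trans (by gcongr)) (hconv μ hμ)
    _ = _ := by ring
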